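/- arXiv:2004.06858 — 3 statements merged into one kernel-verified Lean document; each statement's English description precedes it below -/
import Mathlib

section
/- Consider the closed-loop event-based system: under the standing assumptions (a uniform linear bound ‖π_j(mN_d, x)‖ ≤ ρ‖x‖ on the feedback laws and a class-KL bound ‖x[mN_d]‖ ≤ β(‖x[0]‖, mN_d) for the down-sampled states of every closed-loop trajectory with ‖x[0]‖ < δ₀). Then the origin is asymptotically stable for the original closed-loop system: for every ε > 0 there exists δ > 0 such that every closed-loop trajectory with ‖x[0]‖ < δ satisfies ‖x[k]‖ < ε for all k ∈ ℕ, and moreover x[k] → 0 as k → ∞. -/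
open Filter Topology

/-- A function `β : [0,∞) × [0,∞) → [0,∞)` is of class KL if for each fixed `s` the map
`r ↦ β r s` is continuous, strictly increasing and vanishes at `r = 0`, and for each fixed `r`
the map `s ↦ β r s` is non-increasing and tends to `0` as `s → ∞`. -/
def IsClassKL (β : ℝ → ℝ → ℝ) : Prop :=
  (∀ r ∈ Set.Ici (0:ℝ), ∀ s ∈ Set.Ici (0:ℝ), 0 ≤ β r s) ∧
  (∀ s ∈ Set.Ici (0:ℝ), ContinuousOn (fun r => β r s) (Set.Ici 0) ∧
      StrictMonoOn (fun r => β r s) (Set.Ici 0) ∧ β 0 s = 0) ∧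
  (∀ r ∈ Set.Ici (0:ℝ), AntitoneOn (fun s => β r s) (Set.Ici 0) ∧
      Tendsto (fun s => β r s) atTop (𝓝 0))

/-- A closed-loop trajectory of the event-based system
`x[m N_d + j + 1] = A x[m N_d + j] + B π_j(m N_d, x[m N_d])`. -/
def IsClosedLoopTrajectory {n p : ℕ}
    (A : EuclideanSpace ℝ (Fin n) →L[ℝ] EuclideanSpace ℝ (Fin n))
    (B : EuclideanSpace ℝ (Fin p) →L[ℝ] EuclideanSpace ℝ (Fin n))
    (Nd : ℕ) (π : ℕ → ℕ → EuclideanSpace ℝ (Fin n) → EuclideanSpace ℝ (Fin p))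
    (x : ℕ → EuclideanSpace ℝ (Fin n)) : Prop :=
  ∀ m : ℕ, ∀ j < Nd,
    x (m * Nd + j + 1) = A (x (m * Nd + j)) + B (π j (m * Nd) (x (m * Nd)))

/-- Under a uniform linear bound on the feedback laws and a class-KL bound for the
down-sampled closed-loop states, the origin is asymptotically stable for the original
closed-loop system. -/
theorem event_based_asymptotic_stability {n p : ℕ}
    (A : EuclideanSpace ℝ (Fin n) →L[ℝ] EuclideanSpace ℝ (Fin n))
    (B : EuclideanSpace ℝ (Fin p) →L[ℝ] EuclideanSpace ℝ (Fin n))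
    (Nd : ℕ) (hNd : 1 ≤ Nd)
    (π : ℕ → ℕ → EuclideanSpace ℝ (Fin n) → EuclideanSpace ℝ (Fin p))
    (ρ : ℝ) (hρ : 0 < ρ)
    (hπ : ∀ m : ℕ, ∀ j < Nd, ∀ x : EuclideanSpace ℝ (Fin n),
      ‖π j (m * Nd) x‖ ≤ ρ * ‖x‖)
    (δ₀ : ℝ) (hδ₀ : 0 < δ₀) (β : ℝ → ℝ → ℝ) (hβ : IsClassKL β)
    (hdown : ∀ x : ℕ → EuclideanSpace ℝ (Fin n), IsClosedLoopTrajectory A B Nd π x →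
      ‖x 0‖ < δ₀ → ∀ m : ℕ, ‖x (m * Nd)‖ ≤ β ‖x 0‖ (m * Nd)) :
    ∀ ε > 0, ∃ δ > 0, ∀ x : ℕ → EuclideanSpace ℝ (Fin n),
      IsClosedLoopTrajectory A B Nd π x → ‖x 0‖ < δ →
        (∀ k : ℕ, ‖x k‖ < ε) ∧ Tendsto x atTop (𝓝 0) := by
  obtain ⟨-, hβ1, hβ2⟩ := hβ
  set a : ℝ := ‖A‖ + ‖B‖ * ρ + 1 with ha
  have hBρ : 0 ≤ ‖B‖ * ρ := by positivity
  have hA0 : 0 ≤ ‖A‖ := norm_nonneg A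
  have ha1 : 1 ≤ a := by linarith
  set C : ℝ := a ^ Nd with hC
  have hC0 : 0 < C := by positivity
  have key : ∀ x : ℕ → EuclideanSpace ℝ (Fin n), IsClosedLoopTrajectory A B Nd π x →
      ∀ m j : ℕ, j ≤ Nd → ‖x (m * Nd + j)‖ ≤ a ^ j * ‖x (m * Nd)‖ := by
    intro x hx m j
    induction j with
    | zero => intro _; simp
    | succ j ih =>
      intro hj
      have ih' := ih (by omega)
      rw [← add_assoc, hx m j (by omega)]
      have h1 := A.le_opNorm (x (m * Nd + j))
      have h2 := B.le_opNorm (π j (m * Nd) (x (m * Nd)))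
      have h3 := mul_le_mul_of_nonneg_left (hπ m j (by omega) (x (m * Nd))) (norm_nonneg B)
      have h4 := mul_le_mul_of_nonneg_left ih' hA0
      have h5 : 1 ≤ a ^ j := one_le_pow₀ ha1
      have hn := norm_nonneg (x (m * Nd))
      have h6 : ‖x (m * Nd)‖ ≤ a ^ j * ‖x (m * Nd)‖ := le_mul_of_one_le_left hn h5
      have h7 := mul_le_mul_of_nonneg_left h6 hBρ
      have h8 := norm_add_le (A (x (m * Nd + j))) (B (π j (m * Nd) (x (m * Nd))))
      have h9 : a ^ (j + 1) * ‖x (m * Nd)‖ = ‖A‖ * (a ^ j * ‖x (m * Nd)‖)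
          + ‖B‖ * ρ * (a ^ j * ‖x (m * Nd)‖) + a ^ j * ‖x (m * Nd)‖ := by
        rw [pow_succ]
        nth_rewrite 2 [ha]
        ring
      rw [h9]
      linarith
  have key2 : ∀ x : ℕ → EuclideanSpace ℝ (Fin n), IsClosedLoopTrajectory A B Nd π x →
      ∀ k : ℕ, ‖x k‖ ≤ C * ‖x (k / Nd * Nd)‖ := by
    intro x hx k
    have hlt : k % Nd < Nd := Nat.mod_lt _ (by omega)
    have h := key x hx (k / Nd) (k % Nd) hlt.le
    have he : k / Nd * Nd + k % Nd = k := Nat.div_add_mod' k Nd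
    rw [he] at h
    exact h.trans (mul_le_mul_of_nonneg_right (pow_le_pow_right₀ ha1 hlt.le) (norm_nonneg _))
  intro ε hε
  obtain ⟨hc, -, hz⟩ := hβ1 0 (by simp)
  have hc0 := Metric.continuousOn_iff.1 hc 0 (by simp) (ε / C) (by positivity)
  obtain ⟨δ₁, hδ₁, hδ⟩ := hc0
  refine ⟨min δ₀ δ₁, lt_min hδ₀ hδ₁, fun x hx hx0 => ?_⟩
  have hd := hdown x hx (hx0.trans_le (min_le_left _ _))
  have hb0 : β ‖x 0‖ 0 < ε / C := by
    have h := hδ ‖x 0‖ (norm_nonneg _)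
      (by simpa using hx0.trans_le (min_le_right _ _))
    simp only [hz, Real.dist_eq, sub_zero] at h
    exact (le_abs_self _).trans_lt h
  obtain ⟨hanti, htend⟩ := hβ2 ‖x 0‖ (norm_nonneg _)
  constructor
  · intro k
    have h1 := hd (k / Nd)
    have h0 : (0:ℝ) ≤ ((k / Nd : ℕ) : ℝ) * (Nd : ℝ) := by positivity
    have h2 : β ‖x 0‖ (((k / Nd : ℕ) : ℝ) * (Nd : ℝ)) ≤ β ‖x 0‖ 0 :=
      hanti (Set.mem_Ici.2 le_rfl) (Set.mem_Ici.2 h0) h0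
    have h3 : ‖x (k / Nd * Nd)‖ < ε / C := by linarith
    calc ‖x k‖ ≤ C * ‖x (k / Nd * Nd)‖ := key2 x hx k
      _ < C * (ε / C) := mul_lt_mul_of_pos_left h3 hC0
      _ = ε := by field_simp
  · have hk : Tendsto (fun k : ℕ => ((k / Nd : ℕ) : ℝ) * (Nd : ℝ)) atTop atTop := by
      refine Tendsto.atTop_mul_const (by exact_mod_cast hNd) ?_
      exact tendsto_natCast_atTop_atTop.comp (Nat.tendsto_div_const_atTop (by omega))
    have hlim := (htend.comp hk).const_mul C
    rw [mul_zero] at hlim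
    refine squeeze_zero_norm (fun k => ?_) hlim
    exact (key2 x hx k).trans (mul_le_mul_of_nonneg_left (hd (k / Nd)) hC0.le)
end

section
/- Under the standing assumptions, the origin is Lyapunov stable for the original closed-loop system: for every ε > 0 there exists δ > 0 such that every closed-loop trajectory with ‖x[0]‖ < δ satisfies ‖x[k]‖ < ε for all k ∈ ℕ. -/
open Filter Topology

/-- Under the standing assumptions, the origin is Lyapunov stable for the original
closed-loop system. -/
theorem event_based_lyapunov_stability {n p : ℕ}
    (A : EuclideanSpace ℝ (Fin n) →L[ℝ] EuclideanSpace ℝ (Fin n))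
    (B : EuclideanSpace ℝ (Fin p) →L[ℝ] EuclideanSpace ℝ (Fin n))
    (Nd : ℕ) (hNd : 1 ≤ Nd)
    (π : ℕ → ℕ → EuclideanSpace ℝ (Fin n) → EuclideanSpace ℝ (Fin p))
    (ρ : ℝ) (hρ : 0 < ρ)
    (hπ : ∀ m : ℕ, ∀ j < Nd, ∀ x : EuclideanSpace ℝ (Fin n),
      ‖π j (m * Nd) x‖ ≤ ρ * ‖x‖)
    (δ₀ : ℝ) (hδ₀ : 0 < δ₀) (β : ℝ → ℝ → ℝ) (hβ : IsClassKL β)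
    (hdown : ∀ x : ℕ → EuclideanSpace ℝ (Fin n), IsClosedLoopTrajectory A B Nd π x →
      ‖x 0‖ < δ₀ → ∀ m : ℕ, ‖x (m * Nd)‖ ≤ β ‖x 0‖ (m * Nd)) :
    ∀ ε > 0, ∃ δ > 0, ∀ x : ℕ → EuclideanSpace ℝ (Fin n),
      IsClosedLoopTrajectory A B Nd π x → ‖x 0‖ < δ → ∀ k : ℕ, ‖x k‖ < ε := by
  intro ε hε
  set L : ℝ := ‖A‖ + ‖B‖ * ρ + 1 with hL
  have hBρ : 0 ≤ ‖B‖ * ρ := by positivity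
  have hL1 : 1 ≤ L := by have := norm_nonneg A; linarith
  have hLp : 0 < L ^ Nd := by positivity
  obtain ⟨_, h2, h3⟩ := hβ
  obtain ⟨hc, _, hz⟩ := h2 0 (Set.mem_Ici.2 le_rfl)
  have hc0 := hc 0 (Set.mem_Ici.2 le_rfl)
  rw [Metric.continuousWithinAt_iff] at hc0
  obtain ⟨d, hd, hd'⟩ := hc0 (ε / L ^ Nd) (by positivity)
  refine ⟨min d δ₀, lt_min hd hδ₀, ?_⟩
  intro x hx hx0 k
  have hgrow : ∀ m j : ℕ, j ≤ Nd → ‖x (m * Nd + j)‖ ≤ L ^ j * ‖x (m * Nd)‖ := by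
    intro m j
    induction j with
    | zero => intro _; simp
    | succ j ih =>
      intro hj
      have ih' := ih (by omega)
      have e := hx m j (by omega)
      rw [← add_assoc, e]
      have hLj : 1 ≤ L ^ j := one_le_pow₀ hL1
      have hX := norm_nonneg (x (m * Nd))
      have hXL : ‖x (m * Nd)‖ ≤ L ^ j * ‖x (m * Nd)‖ := le_mul_of_one_le_left hX hLj
      calc ‖A (x (m * Nd + j)) + B (π j (m * Nd) (x (m * Nd)))‖
          ≤ ‖A (x (m * Nd + j))‖ + ‖B (π j (m * Nd) (x (m * Nd)))‖ := norm_add_le _ _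
        _ ≤ ‖A‖ * ‖x (m * Nd + j)‖ + ‖B‖ * ‖π j (m * Nd) (x (m * Nd))‖ :=
            add_le_add (A.le_opNorm _) (B.le_opNorm _)
        _ ≤ ‖A‖ * (L ^ j * ‖x (m * Nd)‖) + ‖B‖ * (ρ * ‖x (m * Nd)‖) := by
            have := hπ m j (by omega) (x (m * Nd))
            gcongr
        _ ≤ ‖A‖ * (L ^ j * ‖x (m * Nd)‖) + ‖B‖ * ρ * (L ^ j * ‖x (m * Nd)‖)
              + L ^ j * ‖x (m * Nd)‖ := by
            have := mul_le_mul_of_nonneg_left hXL hBρ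
            nlinarith
        _ = L ^ (j + 1) * ‖x (m * Nd)‖ := by rw [pow_succ, hL]; ring
  have hsample : ∀ m : ℕ, ‖x (m * Nd)‖ < ε / L ^ Nd := by
    intro m
    have h4 := hdown x hx (hx0.trans_le (min_le_right _ _)) m
    have h5 : β ‖x 0‖ (m * Nd) ≤ β ‖x 0‖ 0 :=
      (h3 ‖x 0‖ (norm_nonneg _)).1 (Set.mem_Ici.2 le_rfl)
        (Set.mem_Ici.2 (by positivity)) (by positivity)
    have h6 := hd' (x := ‖x 0‖) (norm_nonneg _)
      (by simpa using hx0.trans_le (min_le_left _ _))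
    simp only [hz, Real.dist_eq, sub_zero] at h6
    exact h4.trans_lt (h5.trans_lt ((le_abs_self _).trans_lt h6))
  have hk : k / Nd * Nd + k % Nd = k := Nat.div_add_mod' k Nd
  have hmod : k % Nd ≤ Nd := (Nat.mod_lt _ hNd).le
  have h7 := hgrow (k / Nd) (k % Nd) hmod
  rw [hk] at h7
  calc ‖x k‖ ≤ L ^ (k % Nd) * ‖x (k / Nd * Nd)‖ := h7
    _ ≤ L ^ Nd * ‖x (k / Nd * Nd)‖ := by
        gcongr
    _ < L ^ Nd * (ε / L ^ Nd) := by
        have := hsample (k / Nd)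
        gcongr
    _ = ε := by field_simp
end

section
/- Under the standing assumptions, the origin is attractive for the original closed-loop system: there exists δ > 0 such that every closed-loop trajectory with ‖x[0]‖ < δ satisfies lim_{k→∞} x[k] = 0. -/
open Filter Topology

/-- Under the standing assumptions, the origin is attractive for the original
closed-loop system. -/
theorem event_based_attractivity {n p : ℕ}
    (A : EuclideanSpace ℝ (Fin n) →L[ℝ] EuclideanSpace ℝ (Fin n))
    (B : EuclideanSpace ℝ (Fin p) →L[ℝ] EuclideanSpace ℝ (Fin n))
    (Nd : ℕ) (hNd : 1 ≤ Nd)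
    (π : ℕ → ℕ → EuclideanSpace ℝ (Fin n) → EuclideanSpace ℝ (Fin p))
    (ρ : ℝ) (hρ : 0 < ρ)
    (hπ : ∀ m : ℕ, ∀ j < Nd, ∀ x : EuclideanSpace ℝ (Fin n),
      ‖π j (m * Nd) x‖ ≤ ρ * ‖x‖)
    (δ₀ : ℝ) (hδ₀ : 0 < δ₀) (β : ℝ → ℝ → ℝ) (hβ : IsClassKL β)
    (hdown : ∀ x : ℕ → EuclideanSpace ℝ (Fin n), IsClosedLoopTrajectory A B Nd π x →
      ‖x 0‖ < δ₀ → ∀ m : ℕ, ‖x (m * Nd)‖ ≤ β ‖x 0‖ (m * Nd)) :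
    ∃ δ > 0, ∀ x : ℕ → EuclideanSpace ℝ (Fin n),
      IsClosedLoopTrajectory A B Nd π x → ‖x 0‖ < δ →
        Tendsto x atTop (𝓝 0) := by
  refine ⟨δ₀, hδ₀, fun x hx h0 => ?_⟩
  have hd := hdown x hx h0
  set K : ℝ := ‖A‖ + ‖B‖ * ρ + 1 with hK
  have hBρ : 0 ≤ ‖B‖ * ρ := by positivity
  have hK1 : 1 ≤ K := by
    have := norm_nonneg A
    linarith
  -- inter-sample bound
  have key : ∀ m j : ℕ, j ≤ Nd → ‖x (m * Nd + j)‖ ≤ K ^ j * ‖x (m * Nd)‖ := by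
    intro m j
    induction j with
    | zero => intro _; simp
    | succ j ih =>
      intro hj
      have ih' := ih (by omega)
      have hj' : j < Nd := by omega
      have h1 : ‖x (m * Nd + (j + 1))‖ ≤
          ‖A‖ * ‖x (m * Nd + j)‖ + ‖B‖ * ‖π j (m * Nd) (x (m * Nd))‖ := by
        rw [← add_assoc, hx m j hj']
        exact (norm_add_le _ _).trans (add_le_add (A.le_opNorm _) (B.le_opNorm _))
      have h2 : ‖A‖ * ‖x (m * Nd + j)‖ ≤ ‖A‖ * (K ^ j * ‖x (m * Nd)‖) :=
        mul_le_mul_of_nonneg_left ih' (norm_nonneg _)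
      have h3 : ‖B‖ * ‖π j (m * Nd) (x (m * Nd))‖ ≤ ‖B‖ * (ρ * ‖x (m * Nd)‖) :=
        mul_le_mul_of_nonneg_left (hπ m j hj' _) (norm_nonneg _)
      have h4 : ‖x (m * Nd)‖ ≤ K ^ j * ‖x (m * Nd)‖ :=
        le_mul_of_one_le_left (norm_nonneg _) (one_le_pow₀ hK1)
      have h5 := mul_le_mul_of_nonneg_left h4 hBρ
      have h6 : 0 ≤ K ^ j * ‖x (m * Nd)‖ := by positivity
      calc ‖x (m * Nd + (j + 1))‖
          ≤ ‖A‖ * (K ^ j * ‖x (m * Nd)‖) + ‖B‖ * ρ * (K ^ j * ‖x (m * Nd)‖)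
            + K ^ j * ‖x (m * Nd)‖ := by linarith
        _ = K ^ (j + 1) * ‖x (m * Nd)‖ := by rw [pow_succ]; rw [hK]; ring
  have bound : ∀ k : ℕ, ‖x k‖ ≤ K ^ Nd * β ‖x 0‖ (((k / Nd : ℕ) : ℝ) * Nd) := by
    intro k
    have hlt : k % Nd < Nd := Nat.mod_lt _ hNd
    have h := key (k / Nd) (k % Nd) hlt.le
    rw [Nat.div_add_mod'] at h
    refine h.trans (mul_le_mul ?_ (hd _) (norm_nonneg _) (by positivity))
    exact pow_le_pow_right₀ hK1 hlt.le
  have ht : Tendsto (fun k : ℕ => ((k / Nd : ℕ) : ℝ) * Nd) atTop atTop :=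
    (tendsto_natCast_atTop_atTop.comp (Nat.tendsto_div_const_atTop (by omega))).atTop_mul_const
      (by exact_mod_cast hNd)
  have hlim := (((hβ.2.2 ‖x 0‖ (norm_nonneg _)).2).comp ht).const_mul (K ^ Nd)
  rw [mul_zero] at hlim
  exact squeeze_zero_norm bound hlim
end
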